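/- Let s and t be coprime integers greater than 1. There is a unique (s,t)-core partition κ_{s,t} of maximal size; its size is (s²−1)(t²−1)/24, and κ_{s,t} is self-conjugate. -/

import Mathlib

/-- A partition: a weakly decreasing sequence of natural numbers (indexed from 0)
that is eventually zero.  `parts i` is the (i+1)-st largest part (0 if `i` exceeds
the number of parts). -/
structure NPartition where
  parts : ℕ → ℕ
  antitone : ∀ ⦃i j : ℕ⦄, i ≤ j → parts j ≤ parts i
  eventually_zero : ∃ N, ∀ i, N ≤ i → parts i = 0

namespace NPartition

/-- The size of a partition: the sum of its parts. -/
noncomputable def size (lam : NPartition) : ℕ := ∑ᶠ i, lam.parts i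

/-- The number of (positive) parts of a partition. -/
noncomputable def numParts (lam : NPartition) : ℕ := sInf {N | lam.parts N = 0}

/-- The conjugate partition: `conj.parts j` is the number of rows whose part exceeds `j`,
i.e. the length of column `j` of the Young diagram. -/
noncomputable def conj (lam : NPartition) : NPartition where
  parts := fun j => ((Finset.range lam.numParts).filter (fun i => j < lam.parts i)).card
  antitone := by
    intro a b hab
    apply Finset.card_le_card
    intro x hx
    simp only [Finset.mem_filter] at hx ⊢
    exact ⟨hx.1, lt_of_le_of_lt hab hx.2⟩
  eventually_zero := by
    refine ⟨lam.parts 0, fun j hj => ?_⟩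
    simp only [Finset.card_eq_zero, Finset.filter_eq_empty_iff]
    intro i _
    exact not_lt.mpr (le_trans (lam.antitone (Nat.zero_le i)) hj)

/-- The hook length of the box in row `i`, column `j` (both 0-indexed) of the Young
diagram: arm + leg + 1. -/
noncomputable def hookLength (lam : NPartition) (i j : ℕ) : ℕ :=
  (lam.parts i - (j + 1)) + (lam.conj.parts j - (i + 1)) + 1

/-- `lam` is an `s`-core: no box of its Young diagram has hook length `s`. -/
noncomputable def IsCore (s : ℕ) (lam : NPartition) : Prop :=
  ∀ i j, j < lam.parts i → lam.hookLength i j ≠ s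

/-- The empty partition. -/
def emptyP : NPartition := ⟨fun _ => 0, fun _ _ _ => le_rfl, ⟨0, fun _ _ => rfl⟩⟩

/-- The parts of the partition obtained from `lam` by removing the (rim) hook with
corner box `(i, j)` (0-indexed). -/
noncomputable def removeHookParts (lam : NPartition) (i j : ℕ) : ℕ → ℕ := fun r =>
  if r < i then lam.parts r
  else if r + 1 < lam.conj.parts j then lam.parts (r + 1) - 1
  else if r + 1 = lam.conj.parts j then j
  else lam.parts r

/-- `mu` is obtained from `lam` by removing a single hook of length `s`. -/
noncomputable def RemoveHookStep (s : ℕ) (lam mu : NPartition) : Prop :=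
  ∃ i j, j < lam.parts i ∧ lam.hookLength i j = s ∧
    ∀ r, mu.parts r = lam.removeHookParts i j r

/-- `core` is the `s`-core of `lam`: it is obtained from `lam` by repeatedly removing
hooks of length `s`, and no hook of length `s` remains. -/
noncomputable def HasSCore (s : ℕ) (lam core : NPartition) : Prop :=
  Relation.ReflTransGen (RemoveHookStep s) lam core ∧ IsCore s core

/-- The bead-set of `lam` with shift `k`: the set `{0, …, k-1} ∪ {h + k : h a
first-column hook length of `lam`}`.  (The first-column hook length of row `i`
(0-indexed) is `parts i + (m - (i+1))` where `m` is the number of parts.) -/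
noncomputable def beadSet (lam : NPartition) (k : ℕ) : Finset ℕ :=
  Finset.range k ∪ (Finset.range lam.numParts).image
    (fun i => lam.parts i + (lam.numParts - (i + 1)) + k)

/-- `X` is a bead-set for `lam`. -/
noncomputable def IsBeadSet (lam : NPartition) (X : Finset ℕ) : Prop :=
  ∃ k, X = lam.beadSet k

/-- The minimal bead-set of `lam` (shift `k = 0`), i.e. its set of first-column
hook lengths. -/
noncomputable def minBeadSet (lam : NPartition) : Finset ℕ := lam.beadSet 0

/-- `X` is the bead-set of `lam` normalized with respect to `s`: the size of `X`
is divisible by `s`, with the least possible shift `k`. -/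
noncomputable def IsNormalizedBeadSet (s : ℕ) (lam : NPartition) (X : Finset ℕ) : Prop :=
  ∃ k, X = lam.beadSet k ∧ (lam.beadSet k).card % s = 0 ∧
    ∀ k' < k, (lam.beadSet k').card % s ≠ 0

end NPartition

/-- Runner `i` of the `s`-abacus of the bead-set `X`:  `X_i = {j : i + j·s ∈ X}`. -/
def runner (s i : ℕ) (X : Finset ℕ) : Finset ℕ :=
  (Finset.range (X.sup id + 1)).filter (fun j => i + j * s ∈ X)

/-- The staircase partition `τ_ℓ = (ℓ, ℓ-1, …, 1)`. -/
def staircase (l : ℕ) : NPartition :=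
  ⟨fun i => l - i, fun _ _ hij => Nat.sub_le_sub_left hij l,
   ⟨l, fun i hi => Nat.sub_eq_zero_of_le hi⟩⟩

/-- `P_{s,t}`: the set of positive integers not expressible as a nonnegative integer
combination of `s` and `t`. -/
def Pst (s t : ℕ) : Set ℕ := {n | 0 < n ∧ ¬ ∃ a b : ℕ, n = a * s + b * t}



/-! ### Quadratic inequality on cyclic sequences -/

lemma stc_iter {s t : ℕ} (a : ZMod s → ℤ) (h : ∀ r, a (r + t) ≤ a r + t) (m : ℕ) (r : ZMod s) :
    a (r + m * t) ≤ a r + m * t := by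
  induction m with
  | zero => simp
  | succ m ih =>
    have := h (r + m * t)
    push_cast
    rw [show r + ((m : ZMod s) + 1) * t = r + m * t + t by ring]
    linarith

lemma stc_iter' {s t : ℕ} (a : ZMod s → ℤ) (h : ∀ r, a (r + t) ≤ a r + t) (m : ℕ) (hm : m ≤ s)
    (r : ZMod s) : a r ≤ a (r + m * t) + ((s : ℤ) - m) * t := by
  have := stc_iter a h (s - m) (r + m * t)
  rw [Nat.cast_sub hm, Nat.cast_sub hm] at this
  simpa [show r + (m : ZMod s) * t + ((s : ZMod s) - m) * t = r by simp] using this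

/-- The nonnegative defect. -/
def stcD (s t : ℕ) (a : ZMod s → ℤ) (m : ℕ) (r : ZMod s) : ℤ :=
  (m * t - (a (r + m * t) - a r)) * ((a (r + m * t) - a r) + ((s : ℤ) - m) * t)

lemma stcD_nonneg {s t : ℕ} (a : ZMod s → ℤ) (h : ∀ r, a (r + t) ≤ a r + t) (m : ℕ) (hm : m ≤ s)
    (r : ZMod s) : 0 ≤ stcD s t a m r := by
  have h1 := stc_iter a h m r
  have h2 := stc_iter' a h m hm r
  unfold stcD
  apply mul_nonneg <;> linarith

lemma stc_bij {s t : ℕ} [NeZero s] (hco : Nat.Coprime s t) (r : ZMod s) (g : ZMod s → ℤ) :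
    ∑ m ∈ Finset.range s, g (r + m * t) = ∑ q, g q := by
  have hu : IsUnit (t : ZMod s) := (ZMod.isUnit_iff_coprime t s).2 hco.symm
  refine Finset.sum_bij (fun m _ => r + (m : ZMod s) * t) (by simp) ?_ ?_ (by simp)
  · intro x hx y hy hxy
    have h1 : (x : ZMod s) = y := hu.mul_right_cancel (add_left_cancel hxy)
    rw [ZMod.natCast_eq_natCast_iff'] at h1
    rwa [Nat.mod_eq_of_lt (Finset.mem_range.1 hx), Nat.mod_eq_of_lt (Finset.mem_range.1 hy)] at h1
  · intro q _
    obtain ⟨u, hu⟩ := hu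
    refine ⟨((q - r) * ↑u⁻¹ : ZMod s).val, by simp [ZMod.val_lt], ?_⟩
    simp [← hu]

lemma stc_sum_id (s : ℕ) : 2 * ∑ m ∈ Finset.range s, (m : ℤ) = s * (s - 1) := by
  induction s with
  | zero => simp
  | succ n ih => rw [Finset.sum_range_succ, mul_add, ih]; push_cast; ring

lemma stc_sum_sq (s : ℕ) :
    6 * ∑ m ∈ Finset.range s, (m : ℤ) ^ 2 = s * (s - 1) * (2 * s - 1) := by
  induction s with
  | zero => simp
  | succ n ih => rw [Finset.sum_range_succ, mul_add, ih]; push_cast; ring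

lemma stc_identity {s t : ℕ} [NeZero s] (hco : Nat.Coprime s t) (a : ZMod s → ℤ) :
    6 * ∑ m ∈ Finset.range s, ∑ r, stcD s t a m r + 12 * (s * ∑ r, a r ^ 2 - (∑ r, a r) ^ 2)
      = (s : ℤ) ^ 2 * (s ^ 2 - 1) * t ^ 2 := by
  have h1 : ∀ m ∈ Finset.range s, ∑ r, stcD s t a m r =
      (t : ℤ) ^ 2 * (s * (s * m - m ^ 2)) - ∑ r, (a (r + m * t) - a r) ^ 2 := by
    intro m _
    have h0 : ∑ r, (a (r + m * t) - a r) = 0 := by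
      rw [Finset.sum_sub_distrib, sub_eq_zero]
      exact Equiv.sum_comp (Equiv.addRight ((m : ZMod s) * t)) a
    have : ∀ r, stcD s t a m r = (t : ℤ) ^ 2 * (s * m - m ^ 2) +
        (2 * m - s) * t * (a (r + m * t) - a r) - (a (r + m * t) - a r) ^ 2 := by
      intro r; unfold stcD; ring
    simp only [this]
    rw [Finset.sum_sub_distrib, Finset.sum_add_distrib, ← Finset.mul_sum, ← Finset.mul_sum, h0]
    simp only [Finset.sum_const, Finset.card_univ, ZMod.card, nsmul_eq_mul]
    ring
  rw [Finset.sum_congr rfl h1, Finset.sum_sub_distrib, ← Finset.mul_sum, ← Finset.mul_sum,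
    Finset.sum_sub_distrib, ← Finset.mul_sum, Finset.sum_comm]
  have h2 : ∀ r : ZMod s, ∑ m ∈ Finset.range s, (a (r + m * t) - a r) ^ 2
      = ∑ q, (a q - a r) ^ 2 := fun r => stc_bij hco r (fun q => (a q - a r) ^ 2)
  simp only [h2]
  have h3 : ∑ r : ZMod s, ∑ q : ZMod s, (a q - a r) ^ 2
      = 2 * (s * ∑ r, a r ^ 2 - (∑ r, a r) ^ 2) := by
    have : ∀ r q, (a q - a r) ^ 2 = a q ^ 2 + a r ^ 2 - 2 * (a r * a q) := by intros; ring
    simp only [this, Finset.sum_sub_distrib, Finset.sum_add_distrib, ← Finset.mul_sum,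
      ← Finset.sum_mul]
    simp [ZMod.card, ← Finset.mul_sum]
    ring
  rw [h3]
  have h4 := stc_sum_id s
  have h5 := stc_sum_sq s
  linear_combination (3 * (t : ℤ) ^ 2 * s ^ 2) * h4 - (t : ℤ) ^ 2 * s * h5

/-! ### Closed finite sets of naturals -/

def StcClosed (s : ℕ) (X : Finset ℕ) : Prop := ∀ x ∈ X, s ≤ x → x - s ∈ X

lemma StcClosed.desc {s : ℕ} {X : Finset ℕ} (h : StcClosed s X) (n e : ℕ) (hn : n + e * s ∈ X) :
    n ∈ X := by
  induction e with
  | zero => simpa using hn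
  | succ e ih =>
    apply ih
    have := h _ hn (by nlinarith)
    rwa [show n + (e + 1) * s - s = n + e * s by
      rw [add_mul, one_mul, ← add_assoc, Nat.add_sub_cancel]] at this

lemma stc_exists_a {s : ℕ} [NeZero s] {X : Finset ℕ} (h : StcClosed s X) :
    ∃ a : ZMod s → ℕ, (∀ r, (a r : ZMod s) = r) ∧ ∀ n : ℕ, n ∈ X ↔ n < a n := by
  classical
  have hex : ∀ r : ZMod s, ∃ n : ℕ, (n : ZMod s) = r ∧ n ∉ X := by
    intro r
    refine ⟨r.val + (X.sup id + 1) * s, by simp, fun hm => ?_⟩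
    have h1 := Finset.le_sup (f := id) hm
    have h2 : 1 ≤ s := NeZero.one_le
    simp only [id] at h1
    nlinarith
  refine ⟨fun r => Nat.find (hex r), fun r => (Nat.find_spec (hex r)).1, fun n => ?_⟩
  constructor
  · intro hn
    by_contra hlt
    push Not at hlt
    obtain ⟨h1, h2⟩ := Nat.find_spec (hex n)
    apply h2
    have h3 := (Nat.modEq_iff_dvd' hlt).1 ((ZMod.natCast_eq_natCast_iff _ _ _).1 h1)
    obtain ⟨e, he⟩ := h3
    apply h.desc _ e
    rw [mul_comm e s, ← he]
    rwa [Nat.add_sub_cancel' hlt]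
  · intro hn
    have := Nat.find_min (hex n) hn
    by_contra hc
    exact this ⟨rfl, hc⟩

lemma stc_telescope {s : ℕ} [NeZero s] {X : Finset ℕ} {a : ZMod s → ℕ}
    (ha : ∀ r, (a r : ZMod s) = r) (hX : ∀ n : ℕ, n ∈ X ↔ n < a n) (G : ℕ → ℤ) :
    ∑ x ∈ X, G (x + s) + ∑ x ∈ Finset.range s, G x = ∑ x ∈ X, G x + ∑ r, G (a r) := by
  classical
  have hinj : Function.Injective a := fun x y hxy => by rw [← ha x, ← ha y, hxy]
  have key : X.map (addRightEmbedding s) ∪ Finset.range s = X ∪ Finset.univ.image a := by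
    ext n
    simp only [Finset.mem_union, Finset.mem_map, addRightEmbedding_apply, Finset.mem_range,
      Finset.mem_image, Finset.mem_univ, true_and]
    have hdiv : ∀ k : ℕ, (k : ZMod s) = n → k < n + s → n < k + s → n = k := by
      intro k hk h1 h2
      have h3 := (ZMod.natCast_eq_natCast_iff _ _ _).1 hk
      exact (Nat.ModEq.eq_of_abs_lt h3 (by rw [abs_lt]; constructor <;> linarith)).symm
    constructor
    · rintro (⟨x, hx, rfl⟩ | hn)
      · rw [hX] at hx
        rw [hX]
        by_cases hc : x + s < a ((x + s : ℕ) : ZMod s)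
        · exact Or.inl hc
        · right
          have : ((x + s : ℕ) : ZMod s) = x := by simp
          rw [this] at hc
          exact ⟨x, (hdiv _ (by rw [ha, this]) (by omega) (by omega)).symm⟩
      · rw [hX]
        by_cases hc : n < a n
        · exact Or.inl hc
        · right
          exact ⟨n, (hdiv _ (ha n) (by omega) (by omega)).symm⟩
    · intro hh
      by_cases hn : n < s
      · exact Or.inr hn
      left
      refine ⟨n - s, ?_, by omega⟩
      have hc : ((n - s : ℕ) : ZMod s) = n := by
        rw [Nat.cast_sub (by omega)]; simp
      rw [hX, hc]
      have hs : 0 < s := NeZero.pos s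
      rcases hh with h1 | ⟨r, h1⟩
      · rw [hX] at h1; omega
      · have : (n : ZMod s) = r := by rw [← h1, ha]
        rw [this]; omega
  have d1 : Disjoint (X.map (addRightEmbedding s)) (Finset.range s) := by
    rw [Finset.disjoint_left]
    intro x hx
    simp only [Finset.mem_map, addRightEmbedding_apply] at hx
    obtain ⟨y, _, rfl⟩ := hx
    simp
  have d2 : Disjoint X (Finset.univ.image a) := by
    rw [Finset.disjoint_left]
    intro x hx hx'
    simp only [Finset.mem_image, Finset.mem_univ, true_and] at hx'
    obtain ⟨r, rfl⟩ := hx'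
    rw [hX, ha] at hx
    exact lt_irrefl _ hx
  have := congrArg (fun S => ∑ x ∈ S, G x) key
  simp only [Finset.sum_union d1, Finset.sum_union d2, Finset.sum_map,
    addRightEmbedding_apply] at this
  rw [Finset.sum_image (fun x _ y _ h => hinj h)] at this
  exact this

lemma stc_sum_a {s : ℕ} [NeZero s] {X : Finset ℕ} {a : ZMod s → ℕ}
    (ha : ∀ r, (a r : ZMod s) = r) (hX : ∀ n : ℕ, n ∈ X ↔ n < a n) :
    2 * ∑ r, (a r : ℤ) = s * (s - 1) + 2 * s * X.card := by
  have := stc_telescope ha hX (fun x => (x : ℤ))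
  simp only [Nat.cast_add, Finset.sum_add_distrib] at this
  simp at this
  have h4 := stc_sum_id s
  linarith

lemma stc_sum_a2 {s : ℕ} [NeZero s] {X : Finset ℕ} {a : ZMod s → ℕ}
    (ha : ∀ r, (a r : ZMod s) = r) (hX : ∀ n : ℕ, n ∈ X ↔ n < a n) :
    6 * ∑ r, (a r : ℤ) ^ 2 =
      s * (s - 1) * (2 * s - 1) + 12 * s * ∑ x ∈ X, (x : ℤ) + 6 * s ^ 2 * X.card := by
  have := stc_telescope ha hX (fun x => (x : ℤ) ^ 2)
  have h0 : ∀ x : ℕ, ((x + s : ℕ) : ℤ) ^ 2 = (x : ℤ) ^ 2 + 2 * s * x + s ^ 2 := by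
    intro x; push_cast; ring
  simp only [h0, Finset.sum_add_distrib, ← Finset.mul_sum] at this
  simp at this
  have h4 := stc_sum_sq s
  linarith

/-- Energy identity for closed sets. -/
lemma stc_energy {s t : ℕ} [NeZero s] (hco : Nat.Coprime s t) {X : Finset ℕ} {a : ZMod s → ℕ}
    (ha : ∀ r, (a r : ZMod s) = r) (hX : ∀ n : ℕ, n ∈ X ↔ n < a n) (z : ℤ)
    (hz : 2 * ∑ x ∈ X, (x : ℤ) = 2 * z + X.card * (X.card - 1)) :
    24 * s ^ 2 * z + 6 * ∑ m ∈ Finset.range s, ∑ r, stcD s t (fun r => (a r : ℤ)) m r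
      = (s : ℤ) ^ 2 * (s ^ 2 - 1) * (t ^ 2 - 1) := by
  have h1 := stc_sum_a ha hX
  have h2 := stc_sum_a2 ha hX
  have h3 := stc_identity hco (fun r => (a r : ℤ))
  generalize ∑ r, (a r : ℤ) = A at *
  generalize ∑ r, (a r : ℤ) ^ 2 = B at *
  generalize ∑ x ∈ X, (x : ℤ) = C at *
  have hA : 4 * A ^ 2 = (s * (s - 1) + 2 * s * (X.card : ℤ)) ^ 2 := by rw [← h1]; ring
  linear_combination h3 - 2 * s * h2 + 3 * hA - 12 * (s : ℤ) ^ 2 * hz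

lemma stc_a_step {s t : ℕ} {X : Finset ℕ} {a : ZMod s → ℕ} (hc : StcClosed t X)
    (ha : ∀ r, (a r : ZMod s) = r) (hX : ∀ n : ℕ, n ∈ X ↔ n < a n) (r : ZMod s) :
    (a (r + t) : ℤ) ≤ a r + t := by
  by_contra hlt
  push Not at hlt
  have h1 : a r + t ∈ X := by
    rw [hX]
    push_cast
    rw [ha]
    exact_mod_cast hlt
  have h2 := hc _ h1 (by omega)
  rw [Nat.add_sub_cancel, hX, ha] at h2
  exact lt_irrefl _ h2

/-- Vanishing defect forces `a` to be an arithmetic progression. -/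
lemma stc_extremal {s t : ℕ} [NeZero s] (ht : 0 < t) (hco : Nat.Coprime s t) {a : ZMod s → ℤ}
    (h : ∀ r, a (r + t) ≤ a r + t)
    (hd : ∑ m ∈ Finset.range s, ∑ r, stcD s t a m r = 0) (hinj : Function.Injective a) :
    ∃ x0 : ℤ, Finset.univ.image a = (Finset.range s).image (fun j : ℕ => x0 + j * t) := by
  classical
  have hd' : ∀ m ∈ Finset.range s, ∀ r, stcD s t a m r = 0 := by
    intro m hm r
    have h1 := (Finset.sum_eq_zero_iff_of_nonneg (fun m hm => Finset.sum_nonneg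
      (fun r _ => stcD_nonneg a h m (Finset.mem_range.1 hm).le r))).1 hd m hm
    exact (Finset.sum_eq_zero_iff_of_nonneg
      (fun r _ => stcD_nonneg a h m (Finset.mem_range.1 hm).le r)).1 h1 r (Finset.mem_univ _)
  obtain ⟨r0, hr0⟩ := Finite.exists_min a
  refine ⟨a r0, Finset.eq_of_subset_of_card_le ?_ ?_⟩
  · intro y hy
    simp only [Finset.mem_image, Finset.mem_univ, true_and, Finset.mem_range] at hy ⊢
    obtain ⟨q, rfl⟩ := hy
    have hu : IsUnit (t : ZMod s) := (ZMod.isUnit_iff_coprime t s).2 hco.symm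
    obtain ⟨u, hu⟩ := hu
    set m := ((q - r0) * ↑u⁻¹ : ZMod s).val with hm
    have hms : m < s := ZMod.val_lt _
    have hq : r0 + (m : ZMod s) * t = q := by simp [hm, ← hu]
    have h1 := hd' m (Finset.mem_range.2 hms) r0
    unfold stcD at h1
    rw [hq] at h1
    rcases mul_eq_zero.1 h1 with h2 | h2
    · exact ⟨m, hms, by linarith⟩
    · have h3 := hr0 q
      have h4 : (0 : ℤ) < ((s : ℤ) - m) * t := by
        apply mul_pos <;> [skip; exact_mod_cast ht]
        have : (m : ℤ) < s := by exact_mod_cast hms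
        linarith
      linarith
  · rw [Finset.card_image_of_injective _ hinj]
    refine Finset.card_image_le.trans ?_
    simp [ZMod.card]

/-- A closed extremal set is determined by its cardinality. -/
lemma stc_unique {s t : ℕ} [NeZero s] (ht : 0 < t) (hco : Nat.Coprime s t) {X X' : Finset ℕ}
    (hs1 : StcClosed s X) (ht1 : StcClosed t X) (hs2 : StcClosed s X') (ht2 : StcClosed t X')
    (hcard : X.card = X'.card) (z : ℤ)
    (hz : 2 * ∑ x ∈ X, (x : ℤ) = 2 * z + X.card * (X.card - 1))
    (hz' : 2 * ∑ x ∈ X', (x : ℤ) = 2 * z + X'.card * (X'.card - 1))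
    (hmax : 24 * z = ((s : ℤ) ^ 2 - 1) * (t ^ 2 - 1)) : X = X' := by
  classical
  obtain ⟨a, ha, hX⟩ := stc_exists_a hs1
  obtain ⟨a', ha', hX'⟩ := stc_exists_a hs2
  have hs0 : (s : ℤ) ≠ 0 := by exact_mod_cast NeZero.ne s
  have i1 : Function.Injective (fun r => (a r : ℤ)) := fun x y hxy => by
    rw [← ha x, ← ha y, Nat.cast_injective hxy]
  have i2 : Function.Injective (fun r => (a' r : ℤ)) := fun x y hxy => by
    rw [← ha' x, ← ha' y, Nat.cast_injective hxy]
  obtain ⟨x, hx⟩ := stc_extremal ht hco (a := fun r => (a r : ℤ)) (stc_a_step ht1 ha hX)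
    (by have := stc_energy hco ha hX z hz
        have h6 : 6 * ∑ m ∈ Finset.range s, ∑ r, stcD s t (fun r => (a r : ℤ)) m r = 0 := by
          linear_combination this - (s : ℤ) ^ 2 * hmax
        linarith) i1
  obtain ⟨x', hx'⟩ := stc_extremal ht hco (a := fun r => (a' r : ℤ)) (stc_a_step ht2 ha' hX')
    (by have := stc_energy hco ha' hX' z hz'
        have h6 : 6 * ∑ m ∈ Finset.range s, ∑ r, stcD s t (fun r => (a' r : ℤ)) m r = 0 := by
          linear_combination this - (s : ℤ) ^ 2 * hmax
        linarith) i2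
  have key : ∀ (b : ZMod s → ℤ) (y : ℤ), Function.Injective b →
      Finset.univ.image b = (Finset.range s).image (fun j : ℕ => y + j * t) →
      ∑ r, b r = s * y + t * ∑ j ∈ Finset.range s, (j : ℤ) := by
    intro b y hb he
    have h1 : ∑ v ∈ Finset.univ.image b, v = ∑ r, b r :=
      Finset.sum_image (fun x _ y _ h => hb h)
    have h2 : ∑ v ∈ (Finset.range s).image (fun j : ℕ => y + (j : ℤ) * t), v
        = ∑ j ∈ Finset.range s, (y + (j : ℤ) * t) := by
      apply Finset.sum_image
      intro p _ q _ h
      have : (t : ℤ) ≠ 0 := by exact_mod_cast ht.ne'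
      have h' := mul_right_cancel₀ this (add_left_cancel h)
      exact_mod_cast h'
    rw [← h1, he, h2, Finset.sum_add_distrib, ← Finset.sum_mul]
    simp
    ring
  have e1 := key _ x i1 hx
  have e2 := key _ x' i2 hx'
  have e3 := stc_sum_a ha hX
  have e4 := stc_sum_a ha' hX'
  have hxx : x = x' := by
    apply mul_left_cancel₀ hs0
    rw [hcard] at e3
    linarith
  have haa : ∀ r, a r = a' r := by
    intro r
    have : (a r : ℤ) ∈ Finset.univ.image (fun r => (a' r : ℤ)) := by
      rw [hx', ← hxx, ← hx]
      exact Finset.mem_image_of_mem (fun r => (a r : ℤ)) (Finset.mem_univ r)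
    simp only [Finset.mem_image, Finset.mem_univ, true_and] at this
    obtain ⟨q, hq⟩ := this
    have hq' : a' q = a r := by exact_mod_cast hq
    have : q = r := by rw [← ha' q, ← ha r, hq']
    rw [← hq', this]
  ext n
  rw [hX, hX', haa]

lemma stc_bound {s t : ℕ} [NeZero s] (hco : Nat.Coprime s t) {X : Finset ℕ}
    (hs1 : StcClosed s X) (ht1 : StcClosed t X) (z : ℤ)
    (hz : 2 * ∑ x ∈ X, (x : ℤ) = 2 * z + X.card * (X.card - 1)) :
    24 * z ≤ ((s : ℤ) ^ 2 - 1) * (t ^ 2 - 1) := by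
  obtain ⟨a, ha, hX⟩ := stc_exists_a hs1
  have h1 := stc_energy hco ha hX z hz
  have h2 : 0 ≤ ∑ m ∈ Finset.range s, ∑ r, stcD s t (fun r => (a r : ℤ)) m r :=
    Finset.sum_nonneg fun m hm => Finset.sum_nonneg fun r _ =>
      stcD_nonneg _ (stc_a_step ht1 ha hX) m (Finset.mem_range.1 hm).le r
  have hs0 : (0 : ℤ) < (s : ℤ) ^ 2 := by
    have : (0 : ℤ) < s := by exact_mod_cast NeZero.pos s
    positivity
  have h3 : (s : ℤ) ^ 2 * (24 * z) ≤ (s : ℤ) ^ 2 * (((s : ℤ) ^ 2 - 1) * (t ^ 2 - 1)) := by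
    linarith
  exact le_of_mul_le_mul_left h3 hs0

/-- The extremal closed set. -/
lemma stc_exists {s t : ℕ} [NeZero s] (hco : Nat.Coprime s t) :
    ∃ X : Finset ℕ, StcClosed s X ∧ StcClosed t X ∧ ∀ z : ℤ,
      2 * ∑ x ∈ X, (x : ℤ) = 2 * z + X.card * (X.card - 1) →
      24 * z = ((s : ℤ) ^ 2 - 1) * (t ^ 2 - 1) := by
  classical
  obtain ⟨u, hu⟩ : IsUnit (t : ZMod s) := (ZMod.isUnit_iff_coprime t s).2 hco.symm
  let a : ZMod s → ℕ := fun r => (r * ↑u⁻¹ : ZMod s).val * t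
  have ha : ∀ r, (a r : ZMod s) = r := by
    intro r; simp [a, ← hu]
  let X : Finset ℕ := (Finset.range (s * t)).filter (fun n => n < a n)
  have hX : ∀ n : ℕ, n ∈ X ↔ n < a n := by
    intro n
    simp only [X, Finset.mem_filter, Finset.mem_range, and_iff_right_iff_imp]
    intro h
    refine h.trans_le ?_
    exact Nat.mul_le_mul_right _ (ZMod.val_lt _).le
  have hval : ∀ j ∈ Finset.range s, a (0 + (j : ZMod s) * t) = j * t := by
    intro j hj
    simp only [a, zero_add]
    rw [← hu, Units.mul_inv_cancel_right, ZMod.val_natCast,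
      Nat.mod_eq_of_lt (Finset.mem_range.1 hj)]
  have hstep : ∀ r : ZMod s, a (r + t) ≤ a r + t := by
    intro r
    simp only [a]
    rw [add_mul, ← hu, Units.mul_inv]
    calc _ ≤ ((r * ↑u⁻¹ : ZMod s).val + 1) * t := by
          apply Nat.mul_le_mul_right
          refine (ZMod.val_add_le _ _).trans ?_
          gcongr
          rw [← Nat.cast_one, ZMod.val_natCast]
          exact Nat.mod_le _ _
      _ = _ := by ring
  refine ⟨X, ?_, ?_, ?_⟩
  · intro x hx hle
    rw [hX] at hx ⊢
    rw [Nat.cast_sub hle]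
    simp only [CharP.cast_eq_zero, sub_zero]
    omega
  · intro x hx hle
    rw [hX] at hx ⊢
    have := hstep ((x - t : ℕ) : ZMod s)
    rw [← Nat.cast_add, Nat.sub_add_cancel hle] at this
    by_cases ht : t = 0
    · subst ht; simpa using hx
    omega
  · intro z hz
    have h1 := stc_sum_a ha hX
    have h2 := stc_sum_a2 ha hX
    have g1 : ∑ r, (a r : ℤ) = t * ∑ j ∈ Finset.range s, (j : ℤ) := by
      rw [← stc_bij hco 0, Finset.mul_sum]
      refine Finset.sum_congr rfl fun j hj => ?_
      rw [hval j hj]; push_cast; ring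
    have g2 : ∑ r, (a r : ℤ) ^ 2 = t ^ 2 * ∑ j ∈ Finset.range s, (j : ℤ) ^ 2 := by
      rw [← stc_bij hco 0 (fun r => (a r : ℤ) ^ 2), Finset.mul_sum]
      refine Finset.sum_congr rfl fun j hj => ?_
      rw [hval j hj]; push_cast; ring
    have h4 := stc_sum_id s
    have h5 := stc_sum_sq s
    have hs0 : (s : ℤ) ≠ 0 := by exact_mod_cast NeZero.ne s
    rw [g1] at h1
    rw [g2] at h2
    have k1 : 2 * (X.card : ℤ) = (t - 1) * (s - 1) := by
      apply mul_left_cancel₀ hs0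
      linear_combination -h1 + t * h4
    have k2 : 12 * ∑ x ∈ X, (x : ℤ) = (t ^ 2 - 1) * ((s - 1) * (2 * s - 1)) - 6 * s * X.card := by
      apply mul_left_cancel₀ hs0
      linear_combination -h2 + t ^ 2 * h5
    have k3 : 4 * (X.card : ℤ) ^ 2 = ((t - 1) * (s - 1)) ^ 2 := by rw [← k1]; ring
    linear_combination 2 * k2 - 12 * hz - 3 * k3 + (6 - 6 * (s : ℤ)) * k1

/-! ### Partitions and bead sets -/

namespace NPartition

lemma stc_ext {l m : NPartition} (h : ∀ i, l.parts i = m.parts i) : l = m := by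
  cases l; cases m
  simp only [mk.injEq]
  exact funext h

lemma parts_numParts (l : NPartition) : l.parts l.numParts = 0 := by
  obtain ⟨N, hN⟩ := l.eventually_zero
  exact Nat.sInf_mem (s := {N | l.parts N = 0}) ⟨N, hN N le_rfl⟩

lemma lt_numParts (l : NPartition) {i j : ℕ} (h : j < l.parts i) : i < l.numParts := by
  by_contra hc
  have := l.antitone (not_lt.1 hc)
  rw [parts_numParts] at this
  omega

lemma lt_conj_iff (l : NPartition) (i j : ℕ) : i < l.conj.parts j ↔ j < l.parts i := by
  have hset : ∀ k, k ∈ (Finset.range l.numParts).filter (fun i => j < l.parts i) ↔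
      j < l.parts k := by
    intro k
    simp only [Finset.mem_filter, Finset.mem_range, and_iff_right_iff_imp]
    exact fun h => l.lt_numParts h
  show i < ((Finset.range l.numParts).filter (fun i => j < l.parts i)).card ↔ _
  constructor
  · intro h
    by_contra hc
    have hsub : (Finset.range l.numParts).filter (fun i => j < l.parts i) ⊆ Finset.range i := by
      intro k hk
      rw [hset] at hk
      rw [Finset.mem_range]
      by_contra hki
      have := l.antitone (not_lt.1 hki)
      omega
    have := Finset.card_le_card hsub
    rw [Finset.card_range] at this
    omega
  · intro h
    have hsub : Finset.range (i + 1) ⊆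
        (Finset.range l.numParts).filter (fun i => j < l.parts i) := by
      intro k hk
      rw [hset]
      exact h.trans_le (l.antitone (Nat.lt_succ_iff.1 (Finset.mem_range.1 hk)))
    have := Finset.card_le_card hsub
    rw [Finset.card_range] at this
    omega

lemma conj_conj (l : NPartition) : l.conj.conj = l := by
  apply stc_ext
  intro i
  apply eq_of_forall_lt_iff
  intro c
  rw [lt_conj_iff, lt_conj_iff]

lemma isCore_conj {s : ℕ} {l : NPartition} (h : IsCore s l) : IsCore s l.conj := by
  intro i j hij
  rw [lt_conj_iff] at hij
  have := h j i hij
  unfold hookLength at this ⊢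
  rw [conj_conj]
  omega

lemma size_eq (l : NPartition) {N : ℕ} (hN : ∀ i, N ≤ i → l.parts i = 0) :
    l.size = ∑ i ∈ Finset.range N, l.parts i := by
  unfold size
  apply finsum_eq_sum_of_support_subset
  intro i hi
  simp only [Finset.coe_range, Set.mem_Iio]
  by_contra hc
  exact hi (hN i (not_lt.1 hc))

lemma size_conj (l : NPartition) : l.conj.size = l.size := by
  obtain ⟨N, hN⟩ := l.eventually_zero
  obtain ⟨M, hM⟩ := l.conj.eventually_zero
  rw [l.size_eq hN, l.conj.size_eq hM]
  have h := Finset.sum_card_bipartiteAbove_eq_sum_card_bipartiteBelow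
    (s := Finset.range M) (t := Finset.range N) (fun j i => j < l.parts i)
  have h1 : ∀ j, (Finset.bipartiteAbove (fun j i => j < l.parts i) (Finset.range N) j).card
      = l.conj.parts j := by
    intro j
    rw [← Finset.card_range (l.conj.parts j)]
    congr 1
    ext i
    simp only [Finset.bipartiteAbove, Finset.mem_filter, Finset.mem_range, lt_conj_iff,
      and_iff_right_iff_imp]
    intro h
    by_contra hc
    rw [hN i (not_lt.1 hc)] at h
    omega
  have h2 : ∀ i, (Finset.bipartiteBelow (fun j i => j < l.parts i) (Finset.range M) i).card
      = l.parts i := by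
    intro i
    refine Eq.trans ?_ (Finset.card_range (l.parts i))
    congr 1
    ext j
    simp only [Finset.bipartiteBelow, Finset.mem_filter, Finset.mem_range,
      and_iff_right_iff_imp]
    intro h
    by_contra hc
    rw [← lt_conj_iff, hM j (not_lt.1 hc)] at h
    omega
  simpa only [h1, h2] using h

/-- The `k`-th smallest bead among `N`. -/
def bead (l : NPartition) (N k : ℕ) : ℕ := l.parts (N - 1 - k) + k

lemma bead_lt (l : NPartition) (N : ℕ) {k k' : ℕ} (h : k < k') : l.bead N k < l.bead N k' := by
  unfold bead
  have := l.antitone (show N - 1 - k' ≤ N - 1 - k by omega)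
  omega

/-- The bead set with `N` beads. -/
def beads (l : NPartition) (N : ℕ) : Finset ℕ := (Finset.range N).image (l.bead N)

lemma bead_inj (l : NPartition) (N : ℕ) : Function.Injective (l.bead N) :=
  StrictMono.injective (fun _ _ h => l.bead_lt N h)

lemma card_beads (l : NPartition) (N : ℕ) : (l.beads N).card = N := by
  unfold beads
  rw [Finset.card_image_of_injective _ (l.bead_inj N), Finset.card_range]

lemma mem_beads (l : NPartition) (N x : ℕ) :
    x ∈ l.beads N ↔ ∃ i < N, x + i + 1 = l.parts i + N := by
  simp only [beads, Finset.mem_image, Finset.mem_range, bead]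
  constructor
  · rintro ⟨k, hk, rfl⟩
    exact ⟨N - 1 - k, by omega, by omega⟩
  · rintro ⟨i, hi, h⟩
    refine ⟨N - 1 - i, by omega, ?_⟩
    rw [show N - 1 - (N - 1 - i) = i by omega]
    omega

lemma sum_beads (l : NPartition) {N : ℕ} (hN : ∀ i, N ≤ i → l.parts i = 0) :
    2 * ∑ x ∈ l.beads N, (x : ℤ) = 2 * (l.size : ℤ) +
      ((l.beads N).card : ℤ) * ((l.beads N).card - 1) := by
  rw [card_beads, l.size_eq hN]
  unfold beads
  rw [Finset.sum_image (fun x _ y _ h => l.bead_inj N h)]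
  simp only [bead, Nat.cast_add, Finset.sum_add_distrib]
  rw [Finset.sum_range_reflect (fun i => (l.parts i : ℤ)) N, mul_add, stc_sum_id]
  push_cast
  ring

lemma beads_ext {l m : NPartition} {N : ℕ} (hl : ∀ i, N ≤ i → l.parts i = 0)
    (hm : ∀ i, N ≤ i → m.parts i = 0) (h : l.beads N = m.beads N) : l = m := by
  have h1 : (fun k : Fin N => l.bead N k) = (l.beads N).orderEmbOfFin (l.card_beads N) :=
    Finset.orderEmbOfFin_unique _
      (fun x => Finset.mem_image_of_mem _ (Finset.mem_range.2 x.2)) (fun x y h => l.bead_lt N h)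
  have h2 : (fun k : Fin N => m.bead N k) = (l.beads N).orderEmbOfFin (l.card_beads N) :=
    Finset.orderEmbOfFin_unique _
      (fun x => by rw [h]; exact Finset.mem_image_of_mem _ (Finset.mem_range.2 x.2))
      (fun x y h => m.bead_lt N h)
  apply stc_ext
  intro i
  by_cases hi : N ≤ i
  · rw [hl i hi, hm i hi]
  · have := congrFun (h1.trans h2.symm) ⟨N - 1 - i, by omega⟩
    simp only [bead] at this
    rw [show N - 1 - (N - 1 - i) = i by omega] at this
    omega

lemma exists_beads (X : Finset ℕ) : ∃ l : NPartition,
    (∀ i, X.card ≤ i → l.parts i = 0) ∧ l.beads X.card = X := by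
  classical
  set N := X.card with hN
  let e := X.orderEmbOfFin hN.symm
  have hgap : ∀ d k (h : k + d < N), e ⟨k, by omega⟩ + d ≤ e ⟨k + d, h⟩ := by
    intro d
    induction d with
    | zero => intro k h; simp
    | succ d ih =>
      intro k h
      have h1 := ih k (by omega)
      have h2 : e ⟨k + d, by omega⟩ < e ⟨k + (d + 1), h⟩ := by
        apply e.strictMono
        simp [Fin.lt_def]
      omega
  have hge : ∀ k (h : k < N), k ≤ e ⟨k, h⟩ := by
    intro k h
    have := hgap k 0 (by omega)
    simp only [zero_add] at this
    omega
  let f : ℕ → ℕ := fun i => if h : i < N then e ⟨N - 1 - i, by omega⟩ - (N - 1 - i) else 0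
  have hf : ∀ i (h : i < N), f i = e ⟨N - 1 - i, by omega⟩ - (N - 1 - i) := by
    intro i h; simp only [f, dif_pos h]
  have hf0 : ∀ i, N ≤ i → f i = 0 := by
    intro i h; simp only [f, dif_neg (not_lt.2 h)]
  let l : NPartition := ⟨f, by
    intro i j hij
    by_cases hj : j < N
    · rw [hf j hj, hf i (by omega)]
      have h1 := hgap (j - i) (N - 1 - j) (by omega)
      have h2 : (⟨N - 1 - j + (j - i), by omega⟩ : Fin N) = ⟨N - 1 - i, by omega⟩ := by
        ext; simp only; omega
      rw [h2] at h1
      omega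
    · rw [hf0 j (by omega)]; omega, ⟨N, hf0⟩⟩
  have hb : ∀ k (h : k < N), l.bead N k = e ⟨k, h⟩ := by
    intro k h
    have h1 : l.parts (N - 1 - k) = f (N - 1 - k) := rfl
    have h2 : (⟨N - 1 - (N - 1 - k), by omega⟩ : Fin N) = ⟨k, h⟩ := by
      ext; simp only; omega
    unfold bead
    rw [h1, hf _ (by omega), h2]
    have := hge k h
    omega
  refine ⟨l, hf0, ?_⟩
  apply Finset.eq_of_subset_of_card_le
  · intro x hx
    simp only [beads, Finset.mem_image, Finset.mem_range] at hx
    obtain ⟨k, hk, rfl⟩ := hx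
    rw [hb k hk]
    exact Finset.orderEmbOfFin_mem _ _ _
  · rw [card_beads]

lemma closed_of_core {s : ℕ} (hs : 0 < s) {l : NPartition} {N : ℕ}
    (hN : ∀ i, N ≤ i → l.parts i = 0) (h : IsCore s l) : StcClosed s (l.beads N) := by
  intro x hx hsx
  by_contra hy
  obtain ⟨i, hi, hxi⟩ := (l.mem_beads N x).1 hx
  rw [mem_beads] at hy
  push Not at hy
  -- `q` is the first row with bead below `x - s`
  have hex : ∃ q, N ≤ q ∨ l.parts q + N < x - s + q + 1 := ⟨N, Or.inl le_rfl⟩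
  classical
  obtain ⟨q, hq, hmin⟩ : ∃ q, (N ≤ q ∨ l.parts q + N < x - s + q + 1) ∧
      ∀ p < q, ¬ (N ≤ p ∨ l.parts p + N < x - s + p + 1) :=
    ⟨Nat.find hex, Nat.find_spec hex, fun p hp => Nat.find_min hex hp⟩
  have hqN : q ≤ N := by
    by_contra hc
    exact hmin N (by omega) (Or.inl le_rfl)
  have hiq : i < q := by
    by_contra hc
    rcases hq with hq | hq
    · omega
    · have := l.antitone (not_lt.1 hc)
      omega
  have hlo : N ≤ x - s + q := by omega
  obtain ⟨j, hj⟩ : ∃ j, j + N = x - s + q := ⟨x - s + q - N, by omega⟩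
  have hc : l.conj.parts j = q := by
    apply eq_of_forall_lt_iff
    intro c
    rw [lt_conj_iff]
    constructor
    · intro hjc
      by_contra hcq
      have h1 := l.antitone (not_lt.1 hcq)
      rcases hq with hq | hq
      · rw [hN q hq] at h1; omega
      · omega
    · intro hcq
      have h1 := l.antitone (show c ≤ q - 1 by omega)
      have h2 := hmin (q - 1) (by omega)
      have h3 := hy (q - 1) (by omega)
      omega
  have hji : j < l.parts i := by rw [← lt_conj_iff, hc]; exact hiq
  apply h i j hji
  unfold hookLength
  rw [hc]
  omega

lemma core_of_closed {s : ℕ} {l : NPartition} {N : ℕ}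
    (hN : ∀ i, N ≤ i → l.parts i = 0) (h : StcClosed s (l.beads N)) : IsCore s l := by
  intro i j hij hh
  unfold hookLength at hh
  have hic := (l.lt_conj_iff i j).2 hij
  have hiN : ∀ k m, m < l.parts k → k < N := by
    intro k m hk
    by_contra hc
    rw [hN k (not_lt.1 hc)] at hk
    omega
  have hcN : l.conj.parts j ≤ N := by
    have h1 := (l.lt_conj_iff (l.conj.parts j - 1) j).1 (by omega)
    have := hiN _ _ h1
    omega
  have hi := hiN _ _ hij
  have hx : l.parts i + N - i - 1 ∈ l.beads N := (l.mem_beads N _).2 ⟨i, hi, by omega⟩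
  have hy := h _ hx (by omega)
  obtain ⟨k, hk, hk'⟩ := (l.mem_beads N _).1 hy
  have h3 := l.lt_conj_iff k j
  omega

end NPartition

open NPartition in
lemma stc_core_bound {s t : ℕ} (hs : 1 < s) (ht : 1 < t) (hco : Nat.Coprime s t)
    {l : NPartition} (h1 : IsCore s l) (h2 : IsCore t l) :
    24 * (l.size : ℤ) ≤ ((s : ℤ) ^ 2 - 1) * (t ^ 2 - 1) := by
  haveI : NeZero s := ⟨by omega⟩
  obtain ⟨N, hN⟩ := l.eventually_zero
  exact stc_bound hco (closed_of_core (by omega) hN h1) (closed_of_core (by omega) hN h2) _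
    (l.sum_beads hN)

open NPartition in
lemma stc_core_unique {s t : ℕ} (hs : 1 < s) (ht : 1 < t) (hco : Nat.Coprime s t)
    {l m : NPartition} (h1 : IsCore s l) (h2 : IsCore t l) (h3 : IsCore s m) (h4 : IsCore t m)
    (hl : 24 * (l.size : ℤ) = ((s : ℤ) ^ 2 - 1) * (t ^ 2 - 1)) (hm : m.size = l.size) :
    m = l := by
  haveI : NeZero s := ⟨by omega⟩
  obtain ⟨N1, hN1⟩ := l.eventually_zero
  obtain ⟨N2, hN2⟩ := m.eventually_zero
  have hl0 : ∀ i, max N1 N2 ≤ i → l.parts i = 0 := fun i hi => hN1 i (le_trans (le_max_left _ _) hi)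
  have hm0 : ∀ i, max N1 N2 ≤ i → m.parts i = 0 := fun i hi => hN2 i (le_trans (le_max_right _ _) hi)
  have hz := m.sum_beads hm0
  rw [hm] at hz
  exact beads_ext hm0 hl0 (stc_unique (by omega) hco
    (closed_of_core (by omega) hm0 h3) (closed_of_core (by omega) hm0 h4)
    (closed_of_core (by omega) hl0 h1) (closed_of_core (by omega) hl0 h2)
    (by rw [card_beads, card_beads]) _ hz (l.sum_beads hl0) hl)

/-- Let `s, t` be coprime integers greater than 1.  There is a unique
`(s,t)`-core partition of maximal size; its size is `(s²-1)(t²-1)/24`, and it is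
self-conjugate. -/
theorem maximal_st_core_exists_unique (s t : ℕ) (hs : 1 < s) (ht : 1 < t)
    (hco : Nat.Coprime s t) :
    ∃ κ : NPartition,
      (NPartition.IsCore s κ ∧ NPartition.IsCore t κ) ∧
      (∀ μ : NPartition, NPartition.IsCore s μ → NPartition.IsCore t μ →
        μ.size ≤ κ.size) ∧
      (∀ κ' : NPartition, (NPartition.IsCore s κ' ∧ NPartition.IsCore t κ') →
        (∀ μ : NPartition, NPartition.IsCore s μ → NPartition.IsCore t μ →
          μ.size ≤ κ'.size) → κ' = κ) ∧
      κ.size = (s ^ 2 - 1) * (t ^ 2 - 1) / 24 ∧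
      κ = κ.conj := by
  haveI : NeZero s := ⟨by omega⟩
  obtain ⟨X, hX1, hX2, hX3⟩ := stc_exists (s := s) (t := t) hco
  obtain ⟨κ, hκ0, hκX⟩ := NPartition.exists_beads X
  have c1 : NPartition.IsCore s κ := NPartition.core_of_closed hκ0 (by rw [hκX]; exact hX1)
  have c2 : NPartition.IsCore t κ := NPartition.core_of_closed hκ0 (by rw [hκX]; exact hX2)
  have hsz := hX3 κ.size (by have := κ.sum_beads hκ0; rwa [hκX] at this)
  have hmax : ∀ μ : NPartition, NPartition.IsCore s μ → NPartition.IsCore t μ →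
      μ.size ≤ κ.size := by
    intro μ h1 h2
    have := stc_core_bound hs ht hco h1 h2
    omega
  refine ⟨κ, ⟨c1, c2⟩, hmax, ?_, ?_, ?_⟩
  · intro κ' h h'
    exact stc_core_unique hs ht hco c1 c2 h.1 h.2 hsz
      (le_antisymm (hmax κ' h.1 h.2) (h' κ c1 c2))
  · have h1 : 1 ≤ s ^ 2 := Nat.one_le_pow _ _ (by omega)
    have h2 : 1 ≤ t ^ 2 := Nat.one_le_pow _ _ (by omega)
    have : 24 * κ.size = (s ^ 2 - 1) * (t ^ 2 - 1) := by
      zify [h1, h2]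
      exact hsz
    rw [← this]
    omega
  · exact (stc_core_unique hs ht hco c1 c2 (NPartition.isCore_conj c1)
      (NPartition.isCore_conj c2) hsz κ.size_conj).symm
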